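/- arXiv:1907.01243 — 2 statements merged into one kernel-verified Lean document; each statement's English description precedes it below -/
import Mathlib

section
/- Fix a point u in the plane ℝ² and a finite set E of edges, each edge e given by two endpoints and drawn as the closed segment between them. For a point p ∈ ℝ², let coE(u,p) denote the set of edges e ∈ E whose segment is disjoint from the closed segment from u to p. Then the set system (E, {coE(u,p) : p ∈ ℝ²}) has VC-dimension at most 8; that is, no subset A ⊆ E with |A| = 9 is shattered by the family {coE(u,p) : p ∈ ℝ²}. -/
def MeetsC (x1 y1 x2 y2 X Y : ℝ) : Prop :=
  ∃ r s : ℝ, 0 ≤ r ∧ r ≤ 1 ∧ 0 ≤ s ∧ s ≤ 1 ∧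
    (1 - r) * x1 + r * x2 = s * X ∧ (1 - r) * y1 + r * y2 = s * Y

lemma MeetsC.swap {x1 y1 x2 y2 X Y : ℝ} (h : MeetsC x1 y1 x2 y2 X Y) :
    MeetsC x2 y2 x1 y1 X Y := by
  obtain ⟨r, s, h1, h2, h3, h4, h5, h6⟩ := h
  exact ⟨1 - r, s, by linarith, by linarith, h3, h4, by linarith, by linarith⟩

lemma MeetsC.refl_y {x1 y1 x2 y2 X Y : ℝ} (h : MeetsC x1 y1 x2 y2 X Y) :
    MeetsC x1 (-y1) x2 (-y2) X (-Y) := by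
  obtain ⟨r, s, h1, h2, h3, h4, h5, h6⟩ := h
  exact ⟨r, s, h1, h2, h3, h4, h5, by linarith⟩

/-- admissible cones in the closed upper half-plane -/
def IsCone (C : ℝ → ℝ → Prop) : Prop :=
  (∀ X Y, C X Y ↔ (Y = 0 ∧ 0 ≤ X)) ∨ ∃ m : ℝ, ∀ X Y, C X Y ↔ (0 ≤ Y ∧ m * Y ≤ X)

lemma IsCone.total {C D : ℝ → ℝ → Prop} (hC : IsCone C) (hD : IsCone D) :
    (∀ X Y, C X Y → D X Y) ∨ (∀ X Y, D X Y → C X Y) := by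
  rcases hC with hC | ⟨m, hC⟩ <;> rcases hD with hD | ⟨n, hD⟩
  · left; intro X Y h; rw [hC] at h; rwa [hD]
  · left; intro X Y h; rw [hC] at h; rw [hD]; obtain ⟨rfl, h⟩ := h; simpa using h
  · right; intro X Y h; rw [hD] at h; rw [hC]; obtain ⟨rfl, h⟩ := h; simpa using h
  · rcases le_total m n with h | h
    · right; intro X Y h1; rw [hD] at h1; rw [hC]; exact ⟨h1.1, by nlinarith [h1.1, h1.2]⟩
    · left; intro X Y h1; rw [hC] at h1; rw [hD]; exact ⟨h1.1, by nlinarith [h1.1, h1.2]⟩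

def LData (M : ℝ → ℝ → Prop) : Prop :=
  ∃ (C : ℝ → ℝ → Prop) (k t : ℝ), IsCone C ∧
    ∀ X Y, 0 ≤ Y → (M X Y ↔ (C X Y ∧ t ≤ X + k * Y))

lemma ldata_aux (x1 y1 x2 y2 D : ℝ) (hD : 0 < D) (h1 : 0 ≤ y1) (h2 : y2 ≤ 0)
    (h0 : ¬ MeetsC x1 y1 x2 y2 0 0) (hm : MeetsC x1 y1 x2 y2 D 0) :
    LData (MeetsC x1 y1 x2 y2) := by
  obtain ⟨r0, s0, hr0, hr1, hs0, hs1, hx, hy⟩ := hm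
  have hs0' : 0 < s0 := by
    rcases hs0.lt_or_eq with h | h
    · exact h
    · exact absurd ⟨r0, 0, hr0, hr1, le_rfl, zero_le_one, by rw [hx, ← h]; ring,
        by rw [hy]; ring⟩ h0
  have ht0 : 0 < s0 * D := mul_pos hs0' hD
  rcases h1.lt_or_eq with hy1 | hy1
  · -- nondegenerate
    have hd : 0 < y1 - y2 := by linarith
    obtain ⟨t, ht⟩ : ∃ t, t = s0 * D := ⟨_, rfl⟩
    rw [← ht] at ht0 hx
    have hr0e : r0 * (y1 - y2) = y1 := by linarith
    have hline : t * (y1 - y2) = x2 * y1 - x1 * y2 := by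
      rw [← hx]; linear_combination (x2 - x1) * hr0e
    refine ⟨fun X Y => 0 ≤ Y ∧ (x1 / y1) * Y ≤ X, t / y1 - x1 / y1, t,
      Or.inr ⟨_, fun _ _ => Iff.rfl⟩, ?_⟩
    intro X Y hY
    have e1 : ∀ Z, (x1 / y1) * Y ≤ Z ↔ x1 * Y ≤ Z * y1 := by
      intro Z
      rw [div_mul_eq_mul_div, div_le_iff₀ hy1]
    have e2 : t ≤ X + (t / y1 - x1 / y1) * Y ↔ t * y1 ≤ X * y1 + (t - x1) * Y := by
      have : X + (t / y1 - x1 / y1) * Y = (X * y1 + (t - x1) * Y) / y1 := by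
        field_simp
      rw [this, le_div_iff₀ hy1]
    beta_reduce
    rw [e1, e2]
    constructor
    · rintro ⟨r, s, a1, a2, a3, a4, a5, a6⟩
      have hs : 0 < s := by
        rcases a3.lt_or_eq with h | h
        · exact h
        · exact absurd ⟨r, 0, a1, a2, le_rfl, zero_le_one, by rw [a5, ← h]; ring,
            by rw [a6, ← h]; ring⟩ h0
      have hqy : 0 ≤ s * Y := mul_nonneg hs.le hY
      -- on the line
      have hl : s * (X * y1 + (t - x1) * Y) = t * y1 := by
        have : (y1 - y2) * (s * (X * y1 + (t - x1) * Y)) = (y1 - y2) * (t * y1) := by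
          have e : s * (X * y1 + (t - x1) * Y) = (s * X) * y1 + (t - x1) * (s * Y) := by ring
          rw [e, ← a5, ← a6]
          linear_combination ((1 - r) * y1 + r * y2 - y1) * hline
        exact mul_left_cancel₀ hd.ne' this
      have hpos : 0 < t * y1 := mul_pos ht0 hy1
      have hle : s * Y ≤ y1 := by rw [← a6]; nlinarith
      refine ⟨⟨hY, ?_⟩, ?_⟩
      · have : 0 ≤ s * (X * y1 - x1 * Y) := by
          have : s * (X * y1 - x1 * Y) = t * (y1 - s * Y) := by linear_combination hl
          rw [this]; exact mul_nonneg ht0.le (by linarith)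
        have := nonneg_of_mul_nonneg_right this hs
        linarith
      · by_contra hc
        push Not at hc
        have : 0 < X * y1 + (t - x1) * Y := pos_of_mul_pos_right (hl ▸ hpos) hs.le
        nlinarith
    · rintro ⟨⟨-, b1⟩, b2⟩
      have hpos : 0 < t * y1 := mul_pos ht0 hy1
      set W := X * y1 + (t - x1) * Y with hW
      have hWp : 0 < W := by linarith
      obtain ⟨s, hs⟩ : ∃ s, s = t * y1 / W := ⟨_, rfl⟩
      have hsW : s * W = t * y1 := by rw [hs]; field_simp
      have hsp : 0 < s := by rw [hs]; positivity
      have hs1 : s ≤ 1 := by rw [hs, div_le_one hWp]; exact b2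
      have hqy : 0 ≤ s * Y := mul_nonneg hsp.le hY
      have hle : s * Y ≤ y1 := by
        have h3 : 0 ≤ s * (X * y1 - x1 * Y) := mul_nonneg hsp.le (by linarith)
        have : s * (X * y1 - x1 * Y) = t * (y1 - s * Y) := by linear_combination hsW
        rw [this] at h3
        have := nonneg_of_mul_nonneg_right h3 ht0
        linarith
      obtain ⟨r, hr⟩ : ∃ r, r = (y1 - s * Y) / (y1 - y2) := ⟨_, rfl⟩
      have hrd : r * (y1 - y2) = y1 - s * Y := by rw [hr]; field_simp
      refine ⟨r, s, ?_, ?_, hsp.le, hs1, ?_, ?_⟩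
      · rw [hr]; exact div_nonneg (by linarith) hd.le
      · rw [hr, div_le_one hd]; linarith
      · have : (y1 - y2) * y1 * ((1 - r) * x1 + r * x2) = (y1 - y2) * y1 * (s * X) := by
          rw [hW] at hsW
          linear_combination (x2 - x1) * y1 * hrd - (y1 - y2) * hsW - (y1 - s * Y) * hline
        exact mul_left_cancel₀ (mul_pos hd hy1).ne' this
      · linarith
  · subst hy1
    have key : ∀ t : ℝ, 0 < t → (∃ r, 0 ≤ r ∧ r ≤ 1 ∧ (1 - r) * x1 + r * x2 = t ∧ r * y2 = 0) →
        (∀ r, 0 ≤ r → r ≤ 1 → 0 ≤ r * y2 → r * y2 = 0 ∧ t ≤ (1 - r) * x1 + r * x2) →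
        LData (MeetsC x1 0 x2 y2) := by
      rintro t ht ⟨r1, c1, c2, c3, c4⟩ hr
      refine ⟨fun X Y => Y = 0 ∧ 0 ≤ X, 0, t, Or.inl fun _ _ => Iff.rfl, ?_⟩
      intro X Y hY
      constructor
      · rintro ⟨r, s, a1, a2, a3, a4, a5, a6⟩
        have := hr r a1 a2 (by nlinarith [mul_nonneg a3 hY])
        have hs : 0 < s * X := by rw [← a5]; linarith
        have hs' : 0 < s := by
          rcases a3.lt_or_eq with h | h
          · exact h
          · rw [← h] at hs; simp at hs
        have hX : 0 < X := pos_of_mul_pos_right hs a3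
        have hY0 : s * Y = 0 := by linarith
        refine ⟨⟨(mul_eq_zero.1 hY0).resolve_left hs'.ne', hX.le⟩, ?_⟩
        nlinarith
      · rintro ⟨⟨rfl, hX⟩, hX2⟩
        have hXp : 0 < X := by linarith
        refine ⟨r1, t / X, c1, c2, by positivity, ?_, ?_, ?_⟩
        · rw [div_le_one hXp]; linarith
        · rw [c3]; field_simp
        · linarith
    rcases h2.lt_or_eq with hy2 | hy2
    · have hr00 : r0 = 0 := by
        have : r0 * y2 = 0 := by linarith
        exact (mul_eq_zero.1 this).resolve_right hy2.ne
      subst hr00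
      refine key x1 (by linarith) ⟨0, le_rfl, zero_le_one, by ring, by ring⟩ ?_
      intro r a1 a2 a3
      have : r = 0 := by
        by_contra h
        have : 0 < r := lt_of_le_of_ne a1 (Ne.symm h)
        nlinarith
      subst this
      simp
    · subst hy2
      have hx1 : 0 < x1 := by
        by_contra h
        push Not at h
        have : 0 < x2 := by
          by_contra h'
          push Not at h'
          nlinarith
        refine h0 ⟨(-x1) / (x2 - x1), 0, div_nonneg (by linarith) (by linarith), ?_, le_rfl,
          zero_le_one, ?_, by ring⟩
        · rw [div_le_one (by linarith)]; linarith
        · have : x2 - x1 ≠ 0 := by linarith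
          field_simp; ring
      have hx2 : 0 < x2 := by
        by_contra h
        push Not at h
        refine h0 ⟨x1 / (x1 - x2), 0, div_nonneg (by linarith) (by linarith), ?_, le_rfl,
          zero_le_one, ?_, by ring⟩
        · rw [div_le_one (by linarith)]; linarith
        · have : x1 - x2 ≠ 0 := by linarith
          field_simp; ring
      rcases le_total x1 x2 with h | h
      · refine key x1 hx1 ⟨0, le_rfl, zero_le_one, by ring, by ring⟩ ?_
        intro r a1 a2 _
        exact ⟨by ring, by nlinarith⟩
      · refine key x2 hx2 ⟨1, zero_le_one, le_rfl, by ring, by ring⟩ ?_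
        intro r a1 a2 _
        exact ⟨by ring, by nlinarith⟩

lemma ldata (x1 y1 x2 y2 D : ℝ) (hD : 0 < D)
    (h0 : ¬ MeetsC x1 y1 x2 y2 0 0) (hm : MeetsC x1 y1 x2 y2 D 0) :
    LData (MeetsC x1 y1 x2 y2) := by
  have hc : (0 ≤ y1 ∧ y2 ≤ 0) ∨ (0 ≤ y2 ∧ y1 ≤ 0) := by
    obtain ⟨r, s, a1, a2, a3, a4, a5, a6⟩ := hm
    rcases le_total 0 y1 with h | h <;> rcases le_total 0 y2 with h' | h'
    · rcases h.lt_or_eq with g | g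
      · rcases h'.lt_or_eq with g' | g'
        · exfalso
          rcases a1.lt_or_eq with q | q
          · nlinarith [mul_pos q g', mul_nonneg (sub_nonneg.2 a2) h]
          · subst q; linarith
        · left; exact ⟨h, g'.symm.le⟩
      · right; exact ⟨h', g.symm.le⟩
    · left; exact ⟨h, h'⟩
    · right; exact ⟨h', h⟩
    · rcases h.lt_or_eq with g | g
      · rcases h'.lt_or_eq with g' | g'
        · exfalso
          rcases a1.lt_or_eq with q | q
          · nlinarith [mul_pos q (neg_pos.2 g'), mul_nonneg (sub_nonneg.2 a2) (neg_nonneg.2 h)]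
          · subst q; linarith
        · right; exact ⟨g'.symm.le, h⟩
      · left; exact ⟨g.symm.le, h'⟩
  rcases hc with ⟨h1, h2⟩ | ⟨h1, h2⟩
  · exact ldata_aux x1 y1 x2 y2 D hD h1 h2 h0 hm
  · have := ldata_aux x2 y2 x1 y1 D hD h1 h2 (fun h => h0 h.swap) hm.swap
    obtain ⟨C, k, t, hC, h⟩ := this
    exact ⟨C, k, t, hC, fun X Y hY => ⟨fun g => (h X Y hY).1 g.swap, fun g => ((h X Y hY).2 g).swap⟩⟩

lemma four (M : Fin 4 → ℝ → ℝ → Prop) (hM : ∀ i, LData (M i)) :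
    ∃ P : Fin 4 → Prop, ∀ X Y, 0 ≤ Y → ¬ ∀ i, (M i X Y ↔ P i) := by
  by_contra hcon
  push Not at hcon
  choose C k t hC h using hM
  obtain ⟨i0, hi0⟩ : ∃ i0, ∀ j X Y, C i0 X Y → C j X Y := by
    have : ∀ s : Finset (Fin 4), s.Nonempty → ∃ i0, ∀ j ∈ s, ∀ X Y, C i0 X Y → C j X Y := by
      intro s hs
      induction hs using Finset.Nonempty.cons_induction with
      | singleton a => exact ⟨a, by simp⟩
      | cons a s ha hs ih =>
        obtain ⟨i, hi⟩ := ih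
        rcases (hC i).total (hC a) with g | g
        · refine ⟨i, fun j hj => ?_⟩
          rcases Finset.mem_cons.1 hj with rfl | hj
          · exact g
          · exact hi j hj
        · refine ⟨a, fun j hj => ?_⟩
          rcases Finset.mem_cons.1 hj with rfl | hj
          · exact fun _ _ h => h
          · exact fun X Y q => hi j hj X Y (g X Y q)
    obtain ⟨i, hi⟩ := this Finset.univ ⟨0, by simp⟩
    exact ⟨i, fun j => hi j (by simp)⟩
  obtain ⟨i1, m1, h1⟩ := Finset.exists_min_image ({i0}ᶜ : Finset (Fin 4)) k
    (by rw [← Finset.card_pos, Finset.card_compl]; simp)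
  obtain ⟨i3, m3, h3⟩ := Finset.exists_max_image ({i0, i1}ᶜ : Finset (Fin 4)) k
    (by
      rw [← Finset.card_pos, Finset.card_compl]
      have := Finset.card_le_two (a := i0) (b := i1)
      simp only [Fintype.card_fin]; omega)
  obtain ⟨i2, m2⟩ : (({i0, i1, i3}ᶜ : Finset (Fin 4))).Nonempty := by
    rw [← Finset.card_pos, Finset.card_compl]
    have := Finset.card_le_three (a := i0) (b := i1) (c := i3)
    simp only [Fintype.card_fin]; omega
  simp only [Finset.mem_compl, Finset.mem_insert, Finset.mem_singleton, not_or] at m1 m2 m3 h1 h3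
  have k12 := h1 i2 m2.1
  have k23 := h3 i2 ⟨m2.1, m2.2.1⟩
  obtain ⟨X, Y, hY, hp⟩ := hcon (fun i => i ≠ i2)
  obtain ⟨X', Y', hY', hq⟩ := hcon (fun i => i = i0 ∨ i = i2)
  have c0 := ((h i0 X Y hY).1 ((hp i0).2 (Ne.symm m2.1))).1
  have c1 := ((h i1 X Y hY).1 ((hp i1).2 (Ne.symm m2.2.1))).2
  have c3 := ((h i3 X Y hY).1 ((hp i3).2 (Ne.symm m2.2.2))).2
  have c2 : X + k i2 * Y < t i2 := by
    by_contra hc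
    push Not at hc
    exact (hp i2).1 ((h i2 X Y hY).2 ⟨hi0 _ _ _ c0, hc⟩) rfl
  have d0 := ((h i0 X' Y' hY').1 ((hq i0).2 (Or.inl rfl))).1
  have d2 := ((h i2 X' Y' hY').1 ((hq i2).2 (Or.inr rfl))).2
  have d1 : X' + k i1 * Y' < t i1 := by
    by_contra hc
    push Not at hc
    rcases (hq i1).1 ((h i1 X' Y' hY').2 ⟨hi0 _ _ _ d0, hc⟩) with g | g
    · exact m1 g
    · exact m2.2.1 g.symm
  have d3 : X' + k i3 * Y' < t i3 := by
    by_contra hc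
    push Not at hc
    rcases (hq i3).1 ((h i3 X' Y' hY').2 ⟨hi0 _ _ _ d0, hc⟩) with g | g
    · exact m3.1 g
    · exact m2.2.2 g.symm
  generalize k i1 = k1 at *
  generalize k i2 = k2 at *
  generalize k i3 = k3 at *
  -- f = (X - X') + k (Y - Y') : positive at k1, k3, negative at k2
  have f1 : 0 < (X - X') + k1 * (Y - Y') := by linarith
  have f3 : 0 < (X - X') + k3 * (Y - Y') := by linarith
  have f2 : (X - X') + k2 * (Y - Y') < 0 := by linarith
  rcases le_total 0 (Y - Y') with g | g
  · nlinarith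
  · nlinarith

/-- Fix a point `u` in the plane and a finite set `E` of edges (each a pair of
endpoints, drawn as the closed segment between them). The set system on `E` whose
ranges are, for each `p ∈ ℝ²`, the set of edges whose segment is disjoint from the
closed segment from `u` to `p`, has VC-dimension at most 8: no subset `A ⊆ E` of
size 9 is shattered. -/
theorem vc_dimension_coCrossing_le_eight
    (u : EuclideanSpace ℝ (Fin 2))
    (E : Finset (EuclideanSpace ℝ (Fin 2) × EuclideanSpace ℝ (Fin 2))) :
    ¬ ∃ A : Finset (EuclideanSpace ℝ (Fin 2) × EuclideanSpace ℝ (Fin 2)),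
        A ⊆ E ∧ A.card = 9 ∧
        ∀ B ⊆ A, ∃ p : EuclideanSpace ℝ (Fin 2),
          (B : Set (EuclideanSpace ℝ (Fin 2) × EuclideanSpace ℝ (Fin 2))) =
            (A : Set (EuclideanSpace ℝ (Fin 2) × EuclideanSpace ℝ (Fin 2))) ∩
              {e | e ∈ E ∧ Disjoint (segment ℝ e.1 e.2) (segment ℝ u p)} := by
  classical
  rintro ⟨A, hAE, hcard, hsh⟩
  have sh : ∀ P : EuclideanSpace ℝ (Fin 2) × EuclideanSpace ℝ (Fin 2) → Prop,
      ∃ p, ∀ e ∈ A, (¬ Disjoint (segment ℝ e.1 e.2) (segment ℝ u p) ↔ P e) := by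
    intro P
    obtain ⟨p, hp⟩ := hsh (A.filter fun e => ¬ P e) (Finset.filter_subset _ _)
    refine ⟨p, fun e he => ?_⟩
    have := Set.ext_iff.1 hp e
    simp only [Finset.coe_filter, Set.mem_ofPred_eq, Set.mem_inter_iff, Finset.mem_coe, he,
      true_and, hAE he] at this
    rw [← this, not_not]
  obtain ⟨pn, hpn⟩ := sh (fun _ => False)
  obtain ⟨pd, hpd⟩ := sh (fun _ => True)
  have hu : ∀ e ∈ A, u ∉ segment ℝ e.1 e.2 := by
    intro e he hue
    apply (hpn e he).1
    rw [Set.not_disjoint_iff]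
    exact ⟨u, hue, left_mem_segment ℝ u pn⟩
  have hne : A.Nonempty := by rw [← Finset.card_pos]; omega
  have hdu : pd ≠ u := by
    rintro rfl
    obtain ⟨e, he⟩ := hne
    have := (hpd e he).2 trivial
    rw [segment_same, Set.disjoint_singleton_right, not_not] at this
    exact hu e he this
  obtain ⟨a, ha⟩ : ∃ a, a = pd 0 - u 0 := ⟨_, rfl⟩
  obtain ⟨b, hb⟩ : ∃ b, b = pd 1 - u 1 := ⟨_, rfl⟩
  have hD : 0 < a ^ 2 + b ^ 2 := by
    by_contra hc
    have h1 : a = 0 := by nlinarith [sq_nonneg a, sq_nonneg b]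
    have h2 : b = 0 := by nlinarith [sq_nonneg a, sq_nonneg b]
    apply hdu
    ext i
    fin_cases i
    · simp; linarith
    · simp; linarith
  let cx : EuclideanSpace ℝ (Fin 2) → ℝ := fun p => a * (p 0 - u 0) + b * (p 1 - u 1)
  let cy : EuclideanSpace ℝ (Fin 2) → ℝ := fun p => a * (p 1 - u 1) - b * (p 0 - u 0)
  have tr : ∀ (e : EuclideanSpace ℝ (Fin 2) × EuclideanSpace ℝ (Fin 2)) p,
      ¬ Disjoint (segment ℝ e.1 e.2) (segment ℝ u p) ↔
        MeetsC (cx e.1) (cy e.1) (cx e.2) (cy e.2) (cx p) (cy p) := by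
    intro e p
    rw [Set.not_disjoint_iff, segment_eq_image, segment_eq_image]
    constructor
    · rintro ⟨z, ⟨r, ⟨hr0, hr1⟩, rfl⟩, ⟨s, ⟨hs0, hs1⟩, hz⟩⟩
      have z0 := congrArg (fun v : EuclideanSpace ℝ (Fin 2) => v 0) hz
      have z1 := congrArg (fun v : EuclideanSpace ℝ (Fin 2) => v 1) hz
      simp at z0 z1
      refine ⟨r, s, hr0, hr1, hs0, hs1, ?_, ?_⟩
      · simp only [cx]; linear_combination -a * z0 - b * z1
      · simp only [cx, cy]; linear_combination -a * z1 + b * z0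
    · rintro ⟨r, s, hr0, hr1, hs0, hs1, hx, hy⟩
      refine ⟨_, ⟨r, ⟨hr0, hr1⟩, rfl⟩, ⟨s, ⟨hs0, hs1⟩, ?_⟩⟩
      simp only [cx, cy] at hx hy
      ext i
      apply mul_left_cancel₀ hD.ne'
      fin_cases i
      · simp [-mul_eq_mul_left_iff]; linear_combination -a * hx + b * hy
      · simp [-mul_eq_mul_left_iff]; linear_combination -b * hx - a * hy
  have cu : cx u = 0 ∧ cy u = 0 := by simp [cx, cy]
  have cd : cx pd = a ^ 2 + b ^ 2 ∧ cy pd = 0 := by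
    simp only [cx, cy, ← ha, ← hb]; constructor <;> ring
  let f : Fin 9 ≃ A := (A.equivFinOfCardEq hcard).symm
  have g0 : ∀ i, ¬ MeetsC (cx (f i).1.1) (cy (f i).1.1) (cx (f i).1.2) (cy (f i).1.2) 0 0 := by
    intro i hi
    have := (tr (f i).1 u).2 (by rw [cu.1, cu.2]; exact hi)
    rw [segment_same, Set.disjoint_singleton_right, not_not] at this
    exact hu _ (f i).2 this
  have gd : ∀ i, MeetsC (cx (f i).1.1) (cy (f i).1.1) (cx (f i).1.2) (cy (f i).1.2)
      (a ^ 2 + b ^ 2) 0 := by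
    intro i
    have := (tr (f i).1 pd).1 ((hpd _ (f i).2).2 trivial)
    rwa [cd.1, cd.2] at this
  obtain ⟨P, hP⟩ := four (fun i : Fin 4 => MeetsC (cx (f (i.castLE (by norm_num))).1.1)
    (cy (f (i.castLE (by norm_num))).1.1) (cx (f (i.castLE (by norm_num))).1.2)
    (cy (f (i.castLE (by norm_num))).1.2)) (fun i => ldata _ _ _ _ _ hD (g0 _) (gd _))
  let j : Fin 4 → Fin 9 := fun i => ⟨i.1 + 4, by omega⟩
  obtain ⟨Q, hQ⟩ := four (fun i : Fin 4 => MeetsC (cx (f (j i)).1.1)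
    (-cy (f (j i)).1.1) (cx (f (j i)).1.2)
    (-cy (f (j i)).1.2)) (fun i => ldata _ _ _ _ _ hD
      (fun h => g0 (j i) (by simpa using h.refl_y)) (by simpa using (gd (j i)).refl_y))
  let R : Fin 9 → Prop := fun i => if h : i.1 < 4 then P ⟨i.1, h⟩ else
    if h : i.1 - 4 < 4 then Q ⟨i.1 - 4, h⟩ else True
  obtain ⟨p, hp⟩ := sh (fun e => ∃ h : e ∈ A, R (f.symm ⟨e, h⟩))
  have hp' : ∀ i, MeetsC (cx (f i).1.1) (cy (f i).1.1) (cx (f i).1.2) (cy (f i).1.2)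
      (cx p) (cy p) ↔ R i := by
    intro i
    rw [← tr, hp _ (f i).2]
    simp
  rcases le_total 0 (cy p) with h | h
  · refine hP (cx p) (cy p) h fun i => ?_
    rw [hp']
    simp [R]
  · refine hQ (cx p) (-cy p) (by linarith) fun i => ?_
    have e : R (j i) ↔ Q i := by simp [R, j]
    rw [← e, ← hp']
    constructor
    · intro g; simpa using g.refl_y
    · intro g; exact g.refl_y
end

section
/- Let ε ∈ (0,1] and δ ∈ (0,1), let E be a nonempty finite set of edges in the plane ℝ² (each edge given by its two endpoints, drawn as the closed segment between them), and let U be a finite set of points (the neighbors of a vertex v). Assume that for every u ∈ U and every p ∈ ℝ², |coE(u,p)| ≥ ε·|E|. For each u ∈ U let S_u ⊆ E be nonempty with | |S_u ∩ coE(u,p)|/|S_u| − |coE(u,p)|/|E| | ≤ (δ/2)·max(|coE(u,p)|/|E|, ε) for every p ∈ ℝ². Define coCr(p) = Σ_{u∈U} |coE(u,p)| and λ(p) = |E| · Σ_{u∈U} |S_u ∩ coE(u,p)|/|S_u|. If p⋆ ∈ ℝ² satisfies coCr(p) ≤ coCr(p⋆) for all p, and q⋆ ∈ ℝ² satisfies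 λ(p) ≤ λ(q⋆) for all p, then coCr(q⋆) ≥ (1−δ)·coCr(p⋆). -/
open scoped Classical

/-- The set of edges of `E` whose closed segment is disjoint from the closed
segment from `u` to `p`. -/
noncomputable def coE (E : Finset (EuclideanSpace ℝ (Fin 2) × EuclideanSpace ℝ (Fin 2)))
    (u p : EuclideanSpace ℝ (Fin 2)) :
    Finset (EuclideanSpace ℝ (Fin 2) × EuclideanSpace ℝ (Fin 2)) :=
  @Finset.filter _ (fun e => Disjoint (segment ℝ e.1 e.2) (segment ℝ u p))
    (Classical.decPred _) E

/-- Deterministic core of the approximation theorem: in an `ε`-well behaved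
drawing, with per-neighbor relative `(ε, δ/2)`-approximations `S_u`, a position
`q⋆` maximizing the estimate `λ` yields a `(1−δ)`-approximation of the maximum
co-crossing count. -/
theorem approx_max_coCr
    (ε δ : ℝ) (hε : ε ∈ Set.Ioc (0 : ℝ) 1) (hδ : δ ∈ Set.Ioo (0 : ℝ) 1)
    (E : Finset (EuclideanSpace ℝ (Fin 2) × EuclideanSpace ℝ (Fin 2)))
    (hE : E.Nonempty)
    (U : Finset (EuclideanSpace ℝ (Fin 2)))
    (hwell : ∀ u ∈ U, ∀ p : EuclideanSpace ℝ (Fin 2),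
      ε * (E.card : ℝ) ≤ ((coE E u p).card : ℝ))
    (S : EuclideanSpace ℝ (Fin 2) →
      Finset (EuclideanSpace ℝ (Fin 2) × EuclideanSpace ℝ (Fin 2)))
    (hSsub : ∀ u ∈ U, S u ⊆ E) (hSne : ∀ u ∈ U, (S u).Nonempty)
    (happrox : ∀ u ∈ U, ∀ p : EuclideanSpace ℝ (Fin 2),
      |((S u ∩ coE E u p).card : ℝ) / ((S u).card : ℝ) -
          ((coE E u p).card : ℝ) / (E.card : ℝ)| ≤
        (δ / 2) * max (((coE E u p).card : ℝ) / (E.card : ℝ)) ε)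
    (pstar qstar : EuclideanSpace ℝ (Fin 2))
    (hp : ∀ p : EuclideanSpace ℝ (Fin 2),
      (∑ u ∈ U, ((coE E u p).card : ℝ)) ≤ ∑ u ∈ U, ((coE E u pstar).card : ℝ))
    (hq : ∀ p : EuclideanSpace ℝ (Fin 2),
      (E.card : ℝ) * ∑ u ∈ U, ((S u ∩ coE E u p).card : ℝ) / ((S u).card : ℝ) ≤
        (E.card : ℝ) * ∑ u ∈ U, ((S u ∩ coE E u qstar).card : ℝ) / ((S u).card : ℝ)) :
    (1 - δ) * (∑ u ∈ U, ((coE E u pstar).card : ℝ)) ≤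
      ∑ u ∈ U, ((coE E u qstar).card : ℝ) := by
  have hn : (0 : ℝ) < E.card := by exact_mod_cast hE.card_pos
  have key : ∀ u ∈ U, ∀ p : EuclideanSpace ℝ (Fin 2),
      (1 - δ / 2) * ((coE E u p).card : ℝ) ≤
        (E.card : ℝ) * (((S u ∩ coE E u p).card : ℝ) / ((S u).card : ℝ)) ∧
      (E.card : ℝ) * (((S u ∩ coE E u p).card : ℝ) / ((S u).card : ℝ)) ≤
        (1 + δ / 2) * ((coE E u p).card : ℝ) := by
    intro u hu p
    have h := happrox u hu p
    have hw : ε ≤ ((coE E u p).card : ℝ) / (E.card : ℝ) := by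
      rw [le_div_iff₀ hn]
      exact hwell u hu p
    rw [max_eq_left hw, abs_le] at h
    have hc : ((coE E u p).card : ℝ) = E.card * (((coE E u p).card : ℝ) / (E.card : ℝ)) := by
      field_simp
    obtain ⟨h1, h2⟩ := h
    generalize ((coE E u p).card : ℝ) / (E.card : ℝ) = c at *
    generalize ((S u ∩ coE E u p).card : ℝ) / ((S u).card : ℝ) = s at *
    rw [hc]
    constructor
    · have := mul_le_mul_of_nonneg_left h1 hn.le
      linarith
    · have := mul_le_mul_of_nonneg_left h2 hn.le
      linarith
  have hA : (1 - δ / 2) * (∑ u ∈ U, ((coE E u pstar).card : ℝ)) ≤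
      (E.card : ℝ) * ∑ u ∈ U, ((S u ∩ coE E u pstar).card : ℝ) / ((S u).card : ℝ) := by
    rw [Finset.mul_sum, Finset.mul_sum]
    exact Finset.sum_le_sum fun u hu => (key u hu pstar).1
  have hB : (E.card : ℝ) * ∑ u ∈ U, ((S u ∩ coE E u qstar).card : ℝ) / ((S u).card : ℝ) ≤
      (1 + δ / 2) * (∑ u ∈ U, ((coE E u qstar).card : ℝ)) := by
    rw [Finset.mul_sum, Finset.mul_sum]
    exact Finset.sum_le_sum fun u hu => (key u hu qstar).2
  have hC := hq pstar
  have hD := mul_le_mul_of_nonneg_left (hp qstar) (half_pos hδ.1).le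
  linarith
end
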